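/- There is no divisible design Cayley graph with parameters (15, 4, 0, 1, 5, 3); that is, no simple graph on 15 vertices that is simultaneously a divisible design graph with parameters (15, 4, 0, 1, 5, 3) and a Cayley graph. -/

import Mathlib

/-- A divisible design graph (DDG) with parameters `(v, k, l1, l2, m, n)`:
a `k`-regular simple graph on `v = m * n` vertices whose vertex set can be partitioned
into `m` classes of size `n` such that two distinct vertices from the same class have
exactly `l1` common neighbours and two vertices from different classes have exactly `l2`
common neighbours. -/
def IsDDG {V : Type*} (Γ : SimpleGraph V) (v k l1 l2 m n : ℕ) : Prop :=
  Nat.card V = v ∧ v = m * n ∧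
  (∀ x : V, Nat.card {z : V // Γ.Adj x z} = k) ∧
  ∃ c : V → Fin m,
    (∀ i : Fin m, Nat.card {x : V // c x = i} = n) ∧
    (∀ x y : V, x ≠ y → c x = c y →
      Nat.card {z : V // Γ.Adj x z ∧ Γ.Adj y z} = l1) ∧
    (∀ x y : V, c x ≠ c y →
      Nat.card {z : V // Γ.Adj x z ∧ Γ.Adj y z} = l2)

/-- A simple graph is a Cayley graph if and only if its automorphism group contains a
subgroup acting regularly (sharply transitively) on the vertices. -/
def IsCayleyGraph {V : Type*} (Γ : SimpleGraph V) : Prop :=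
  ∃ H : Subgroup (Equiv.Perm V),
    (∀ g ∈ H, ∀ x y : V, Γ.Adj (g x) (g y) ↔ Γ.Adj x y) ∧
    ∀ x y : V, ∃! g : Equiv.Perm V, g ∈ H ∧ g x = y

/-- A group of order `p * q` with primes `p < q` such that `p ∤ q - 1` is cyclic. -/
theorem isCyclic_of_card_eq_prime_mul_prime {G : Type*} [Group G] {p q : ℕ} (hp : p.Prime)
    (hq : q.Prime) (hpq : p < q) (hmod : ¬ 1 ≡ q [MOD p]) (hG : Nat.card G = p * q) :
    IsCyclic G := by
  have hfin : Finite G := Nat.finite_of_card_ne_zero (by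
    rw [hG]
    exact mul_ne_zero hp.ne_zero hq.ne_zero)
  have hcop : p.Coprime q := (Nat.coprime_primes hp hq).2 hpq.ne
  have hZ : IsZGroup G := IsZGroup.of_squarefree (by
    rw [hG, Nat.squarefree_mul hcop]
    exact ⟨hp.squarefree, hq.squarefree⟩)
  have hnormal : ∀ (r : ℕ) (_ : Fact r.Prime) (P : Sylow r G), (P : Subgroup G).Normal := by
    intro r hr P
    have hmul := P.1.card_mul_index
    rw [hG] at hmul
    have hdvd : P.1.index ∣ p * q := Dvd.intro_left _ hmul
    have hnd : ¬ r ∣ P.1.index := P.not_dvd_index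
    have hcard := P.card_dvd_index
    have hone := card_sylow_modEq_one r G
    have hsub : Nat.card (Sylow r G) = 1 → (P : Subgroup G).Normal := fun h ↦ by
      have := (Nat.card_eq_one_iff_unique.1 h).1
      exact P.normal_of_subsingleton
    rcases eq_or_ne r p with rfl | hrp
    · have h := hcard.trans (((hp.coprime_iff_not_dvd.2 hnd).symm).dvd_of_dvd_mul_left hdvd)
      rcases (Nat.dvd_prime hq).1 h with h | h
      · exact hsub h
      · rw [h] at hone
        exact absurd hone.symm hmod
    rcases eq_or_ne r q with rfl | hrq
    · have h := hcard.trans (((hq.coprime_iff_not_dvd.2 hnd).symm).dvd_of_dvd_mul_right hdvd)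
      rcases (Nat.dvd_prime hp).1 h with h | h
      · exact hsub h
      · rw [h] at hone
        exact absurd (hone.eq_of_lt_of_lt hpq hq.one_lt) hp.ne_one
    · obtain ⟨k, hk⟩ := IsPGroup.iff_card.1 P.isPGroup'
      have hrpq : (r ^ k).Coprime (p * q) :=
        (((Nat.coprime_primes hr.out hp).2 hrp).mul_right
          ((Nat.coprime_primes hr.out hq).2 hrq)).pow_left k
      have h1 : Nat.card P.1 = 1 := by
        rw [hk]
        exact Nat.Coprime.eq_one_of_dvd hrpq (hk ▸ Dvd.intro _ hmul)
      rw [Subgroup.card_eq_one] at h1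
      rw [h1]
      infer_instance
  have hnil : Group.IsNilpotent G :=
    ((Group.isNilpotent_of_finite_tfae (G := G)).out 0 3).2 hnormal
  infer_instance

/-- A commutative sharply transitive group of automorphisms of a graph of valency at least three
yields two distinct vertices with at least two common neighbours. -/
theorem exists_two_le_card_common_neighbors {V : Type*} [Finite V] {Γ : SimpleGraph V}
    {H : Subgroup (Equiv.Perm V)} (hcomm : ∀ g ∈ H, ∀ h ∈ H, g * h = h * g)
    (haut : ∀ g ∈ H, ∀ x y : V, Γ.Adj (g x) (g y) ↔ Γ.Adj x y)
    (hreg : ∀ x y : V, ∃! g : Equiv.Perm V, g ∈ H ∧ g x = y) (x : V)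
    (hdeg : 3 ≤ Nat.card {z : V // Γ.Adj x z}) :
    ∃ y, x ≠ y ∧ 2 ≤ Nat.card {z : V // Γ.Adj x z ∧ Γ.Adj y z} := by
  obtain ⟨y, hy⟩ : Nonempty {z : V // Γ.Adj x z} := (Nat.card_pos_iff.1 (by lia)).1
  obtain ⟨a, ⟨haH, rfl⟩, -⟩ := hreg x y
  obtain ⟨w, hw, hwa, hwa'⟩ : ∃ w, Γ.Adj x w ∧ w ≠ a x ∧ w ≠ a⁻¹ x := by
    by_contra! h
    have hss : {z | Γ.Adj x z} ⊆ {a x, a⁻¹ x} := fun z hz ↦ by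
      by_cases hza : z = a x
      · exact Or.inl hza
      · exact Or.inr (h z hz hza)
    have h1 := (Set.ncard_le_ncard hss).trans (Set.ncard_insert_le _ _)
    rw [Set.ncard_singleton] at h1
    have h2 : Nat.card {z : V // Γ.Adj x z} = Set.ncard {z | Γ.Adj x z} := rfl
    lia
  obtain ⟨b, ⟨hbH, rfl⟩, -⟩ := hreg x w
  have hab : a (b x) = b (a x) := congrArg (· x) (hcomm a haH b hbH)
  refine ⟨a (b x), fun h ↦ hwa' ?_, ?_⟩
  · rw [Equiv.Perm.eq_inv_iff_eq, ← h]
  · have h1 : Γ.Adj (a (b x)) (a x) := (haut a haH _ _).2 hw.symm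
    have h2 : Γ.Adj (a (b x)) (b x) := hab ▸ (haut b hbH _ _).2 hy.symm
    have : Nontrivial {z : V // Γ.Adj x z ∧ Γ.Adj (a (b x)) z} :=
      ⟨⟨a x, hy, h1⟩, ⟨b x, hw, h2⟩, fun h ↦ hwa (congrArg Subtype.val h).symm⟩
    exact Finite.one_lt_card

/-- There is no divisible design Cayley graph with parameters
`(15, 4, 0, 1, 5, 3)`. -/
theorem no_ddcg_15_4_0_1_5_3 :
    ¬ ∃ (V : Type) (Γ : SimpleGraph V),
        IsDDG Γ 15 4 0 1 5 3 ∧ IsCayleyGraph Γ := by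
  rintro ⟨V, Γ, ⟨hV, -, hdeg, c, -, hsame, hdiff⟩, H, haut, hreg⟩
  have hfin : Finite V := Nat.finite_of_card_ne_zero (by lia)
  obtain ⟨x⟩ : Nonempty V := (Nat.card_pos_iff.1 (by lia)).1
  have hbij : Function.Bijective fun g : H ↦ g.1 x := by
    refine ⟨fun g h hgh ↦ ?_, fun y ↦ ?_⟩
    · exact Subtype.ext ((hreg x (h.1 x)).unique ⟨g.2, hgh⟩ ⟨h.2, rfl⟩)
    · obtain ⟨g, ⟨hg, hgx⟩, -⟩ := hreg x y
      exact ⟨⟨g, hg⟩, hgx⟩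
  have hH : Nat.card H = 3 * 5 := (Nat.card_eq_of_bijective _ hbij).trans hV
  have hcyc : IsCyclic H := isCyclic_of_card_eq_prime_mul_prime Nat.prime_three Nat.prime_five
    (by norm_num) (by decide) hH
  have hcomm : ∀ g ∈ H, ∀ h ∈ H, g * h = h * g := fun g hg h hh ↦
    congrArg Subtype.val (IsCyclic.isMulCommutative.is_comm.comm (⟨g, hg⟩ : H) ⟨h, hh⟩)
  obtain ⟨y, hxy, hcard⟩ := exists_two_le_card_common_neighbors hcomm haut hreg x
    (by rw [hdeg]; norm_num)
  by_cases hc : c x = c y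
  · rw [hsame x y hxy hc] at hcard
    lia
  · rw [hdiff x y hc] at hcard
    lia
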